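/- arXiv:1203.1569 — 3 statements merged into one kernel-verified Lean document; each statement's English description precedes it below -/
import Mathlib

section
/- Let P be a SPARQL expression, c a reachability criterion, and S ⊂ U a finite set of seed URIs. For every (possibly infinite) Web of Linked Data W: if the (S,c,P)-reachable part of W is finite, then the query result Q^{P,S,c}(W) is a finite set of valuations. -/
/-! Basic vocabulary: pairwise disjoint countably infinite sets of URIs,
blank nodes, literals and variables (realized as constructors of sum-like
inductive types over `ℕ`). -/

abbrev URI := ℕ
abbrev BNode := ℕ
abbrev Lit := ℕ
abbrev Var := ℕ
abbrev Doc := ℕ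

/-- RDF terms: elements of U ∪ B ∪ L (pairwise disjoint). -/
inductive Term
  | uri (u : URI)
  | bnode (b : BNode)
  | lit (l : Lit)

/-- Elements of U ∪ B (possible subjects of RDF triples). -/
inductive Node
  | uri (u : URI)
  | bnode (b : BNode)

def Node.toTerm : Node → Term
  | .uri u => .uri u
  | .bnode b => .bnode b

/-- An RDF triple (s,p,o) ∈ (U ∪ B) × U × (U ∪ B ∪ L). -/
structure RDFTriple where
  s : Node
  p : URI
  o : Term

/-- The RDF terms mentioned in a triple. -/
def RDFTriple.terms (t : RDFTriple) : Set Term :=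
  {t.s.toTerm, Term.uri t.p, t.o}

/-- The URIs mentioned in a triple. -/
def RDFTriple.uris (t : RDFTriple) : Set URI :=
  {u | Term.uri u ∈ t.terms}

/-- The blank nodes mentioned in a set of triples. -/
def bnodesOf (G : Set RDFTriple) : Set BNode :=
  {b | ∃ t ∈ G, Term.bnode b ∈ RDFTriple.terms t}

/-- Subject/predicate position of a triple pattern: V ∪ U. -/
inductive PatSP
  | var (v : Var)
  | uri (u : URI)

/-- Object position of a triple pattern: V ∪ U ∪ L. -/
inductive PatO
  | var (v : Var)
  | uri (u : URI)
  | lit (l : Lit)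

/-- A triple pattern: an element of (V ∪ U) × (V ∪ U) × (V ∪ U ∪ L). -/
structure TriplePattern where
  s : PatSP
  p : PatSP
  o : PatO

def PatSP.vars : PatSP → Set Var
  | .var v => {v}
  | .uri _ => ∅

def PatO.vars : PatO → Set Var
  | .var v => {v}
  | .uri _ => ∅
  | .lit _ => ∅

/-- vars(tp): the variables of a triple pattern. -/
def TriplePattern.vars (tp : TriplePattern) : Set Var :=
  tp.s.vars ∪ tp.p.vars ∪ tp.o.vars

/-- A valuation: a partial map V → U ∪ B ∪ L. -/
def Valu := Var → Option Term

/-- The domain of a valuation. -/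
def Valu.dom (μ : Valu) : Set Var := {v | μ v ≠ none}

/-- Two valuations are compatible if they agree on the intersection of their
domains. -/
def Valu.Compatible (μ1 μ2 : Valu) : Prop :=
  ∀ v t1 t2, μ1 v = some t1 → μ2 v = some t2 → t1 = t2

/-- Union of two (compatible) valuations. -/
def Valu.union (μ1 μ2 : Valu) : Valu :=
  fun v => (μ1 v).orElse (fun _ => μ2 v)

def PatSP.applyS (μ : Valu) : PatSP → Option Node
  | .uri u => some (.uri u)
  | .var v =>
      match μ v with
      | some (.uri u) => some (.uri u)
      | some (.bnode b) => some (.bnode b)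
      | _ => none

def PatSP.applyP (μ : Valu) : PatSP → Option URI
  | .uri u => some u
  | .var v =>
      match μ v with
      | some (.uri u) => some u
      | _ => none

def PatO.applyO (μ : Valu) : PatO → Option Term
  | .uri u => some (.uri u)
  | .lit l => some (.lit l)
  | .var v => μ v

/-- μ[tp]: the RDF triple obtained by applying μ to tp (defined only when all
variables of tp are bound by μ to terms of appropriate kinds). -/
def TriplePattern.apply (μ : Valu) (tp : TriplePattern) : Option RDFTriple :=
  match tp.s.applyS μ, tp.p.applyP μ, tp.o.applyO μ with
  | some s, some p, some o => some ⟨s, p, o⟩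
  | _, _, _ => none

/-- Constants allowed in filter conditions: U ∪ L. -/
inductive Const
  | uri (u : URI)
  | lit (l : Lit)

def Const.toTerm : Const → Term
  | .uri u => .uri u
  | .lit l => .lit l

/-- Filter conditions, built from atoms ?x = c, ?x = ?y, bound(?x)
using ¬, ∧, ∨. -/
inductive FilterCond
  | eqConst (v : Var) (c : Const)
  | eqVar (v1 v2 : Var)
  | bound (v : Var)
  | not (R : FilterCond)
  | and (R1 R2 : FilterCond)
  | or (R1 R2 : FilterCond)

/-- μ satisfies a filter condition R. -/
def FilterCond.Satisfies : FilterCond → Valu → Prop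
  | .eqConst v c, μ => μ v = some c.toTerm
  | .eqVar v1 v2, μ => ∃ t, μ v1 = some t ∧ μ v2 = some t
  | .bound v, μ => μ v ≠ none
  | .not R, μ => ¬ FilterCond.Satisfies R μ
  | .and R1 R2, μ => FilterCond.Satisfies R1 μ ∧ FilterCond.Satisfies R2 μ
  | .or R1 R2, μ => FilterCond.Satisfies R1 μ ∨ FilterCond.Satisfies R2 μ

/-- SPARQL expressions. -/
inductive SparqlExpr
  | pat (tp : TriplePattern)
  | andE (P1 P2 : SparqlExpr)
  | unionE (P1 P2 : SparqlExpr)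
  | optE (P1 P2 : SparqlExpr)
  | filterE (P : SparqlExpr) (R : FilterCond)

/-- ⟦P⟧_G : the evaluation of a SPARQL expression P over a (possibly infinite)
set G of RDF triples. -/
def eval : SparqlExpr → Set RDFTriple → Set Valu
  | .pat tp, G =>
      {μ | Valu.dom μ = tp.vars ∧ ∃ t ∈ G, TriplePattern.apply μ tp = some t}
  | .andE P1 P2, G =>
      {μ | ∃ μ1 ∈ eval P1 G, ∃ μ2 ∈ eval P2 G,
        Valu.Compatible μ1 μ2 ∧ μ = Valu.union μ1 μ2}
  | .unionE P1 P2, G => eval P1 G ∪ eval P2 G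
  | .optE P1 P2, G =>
      {μ | ∃ μ1 ∈ eval P1 G, ∃ μ2 ∈ eval P2 G,
        Valu.Compatible μ1 μ2 ∧ μ = Valu.union μ1 μ2} ∪
      {μ1 | μ1 ∈ eval P1 G ∧ ∀ μ2 ∈ eval P2 G, ¬ Valu.Compatible μ1 μ2}
  | .filterE P R, G => {μ | μ ∈ eval P G ∧ FilterCond.Satisfies R μ}

/-- P is satisfiable: ⟦P⟧_G ≠ ∅ for some set G of RDF triples. -/
def SparqlExpr.Satisfiable (P : SparqlExpr) : Prop :=
  ∃ G : Set RDFTriple, (eval P G).Nonempty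

/-- P is nontrivially satisfiable: some solution binds at least one variable. -/
def SparqlExpr.NontriviallySatisfiable (P : SparqlExpr) : Prop :=
  ∃ G : Set RDFTriple, ∃ μ ∈ eval P G, Valu.dom μ ≠ ∅

/-- P is monotonic: G1 ⊆ G2 implies ⟦P⟧_{G1} ⊆ ⟦P⟧_{G2}. -/
def SparqlExpr.Monotonic (P : SparqlExpr) : Prop :=
  ∀ G1 G2 : Set RDFTriple, G1 ⊆ G2 → eval P G1 ⊆ eval P G2

/-- A Web of Linked Data W = (D, data, adoc): D a countable set of LD documents
(subsets of ℕ are countable), data assigns to each document a finite set of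
RDF triples (distinct documents using disjoint sets of blank nodes), and adoc
is a partial surjective map from URIs to D. -/
structure Web where
  D : Set Doc
  data : Doc → Set RDFTriple
  adoc : URI → Option Doc
  data_fin : ∀ d ∈ D, (data d).Finite
  bnode_disj : ∀ d1 ∈ D, ∀ d2 ∈ D, d1 ≠ d2 →
    Disjoint (bnodesOf (data d1)) (bnodesOf (data d2))
  adoc_mem : ∀ u d, adoc u = some d → d ∈ D
  adoc_surj : ∀ d ∈ D, ∃ u, adoc u = some d

/-- AllData(W) = ⋃_{d ∈ D} data(d). -/
def Web.AllData (W : Web) : Set RDFTriple := ⋃ d ∈ W.D, W.data d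

/-- A Web of Linked Data is finite iff its set of documents is finite. -/
def Web.IsFinite (W : Web) : Prop := W.D.Finite

/-- W1 is an induced subweb of W2. -/
def InducedSubweb (W1 W2 : Web) : Prop :=
  W1.D ⊆ W2.D ∧ (∀ d ∈ W1.D, W1.data d = W2.data d) ∧
  ∀ u d, W1.adoc u = some d ↔ (W2.adoc u = some d ∧ d ∈ W1.D)

/-- A Linked Data query: a function from Webs of Linked Data to sets of
valuations. -/
def LDQuery := Web → Set Valu

def LDQuery.Satisfiable (q : LDQuery) : Prop := ∃ W, (q W).Nonempty

def LDQuery.NontriviallySatisfiable (q : LDQuery) : Prop :=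
  ∃ W, ∃ μ ∈ q W, Valu.dom μ ≠ ∅

def LDQuery.Monotonic (q : LDQuery) : Prop :=
  ∀ W1 W2, InducedSubweb W1 W2 → q W1 ⊆ q W2

/-- The SPARQL_LD (full-Web semantics) query Q^P. -/
def fullWebQuery (P : SparqlExpr) : LDQuery := fun W => eval P (Web.AllData W)

/-- A reachability criterion. -/
def ReachCrit := RDFTriple → URI → SparqlExpr → Bool

/-- c_None : the reachability criterion that always returns false. -/
def cNone : ReachCrit := fun _ _ _ => false

/-- c1 is less restrictive than c2. -/
def LessRestrictive (c1 c2 : ReachCrit) : Prop :=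
  ∀ t u P, c2 t u P = true → c1 t u P = true

/-- A document d is (c,P)-reachable from S in W. -/
inductive Reachable (W : Web) (S : Set URI) (c : ReachCrit) (P : SparqlExpr) : Doc → Prop
  | seed {u : URI} {d : Doc} (hu : u ∈ S) (ha : W.adoc u = some d) :
      Reachable W S c P d
  | step {d' : Doc} {t : RDFTriple} {u : URI} {d : Doc}
      (hr : Reachable W S c P d') (ht : t ∈ W.data d') (hu : u ∈ RDFTriple.uris t)
      (hc : c t u P = true) (ha : W.adoc u = some d) :
      Reachable W S c P d

lemma Reachable.mem_D {W : Web} {S : Set URI} {c : ReachCrit} {P : SparqlExpr}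
    {d : Doc} (h : Reachable W S c P d) : d ∈ W.D := by
  cases h with
  | seed hu ha => exact W.adoc_mem _ _ ha
  | step hr ht hu hc ha => exact W.adoc_mem _ _ ha

lemma Reachable.exists_uri {W : Web} {S : Set URI} {c : ReachCrit} {P : SparqlExpr}
    {d : Doc} (h : Reachable W S c P d) : ∃ u, W.adoc u = some d := by
  cases h with
  | seed hu ha => exact ⟨_, ha⟩
  | step hr ht hu hc ha => exact ⟨_, ha⟩

open Classical in
/-- The restriction of adoc to URIs whose document lies in `Ds`. -/
noncomputable def restrictAdoc (W : Web) (Ds : Set Doc) : URI → Option Doc :=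
  fun u => if (∃ d ∈ Ds, W.adoc u = some d) then W.adoc u else none

lemma restrictAdoc_eq_some (W : Web) (Ds : Set Doc) (u : URI) (d : Doc) :
    restrictAdoc W Ds u = some d ↔ W.adoc u = some d ∧ d ∈ Ds := by
  unfold restrictAdoc
  split
  · rename_i h
    obtain ⟨d', hd', ha⟩ := h
    constructor
    · intro he
      obtain rfl : d = d' := Option.some.inj (he.symm.trans ha)
      exact ⟨he, hd'⟩
    · exact fun h => h.1
  · rename_i h
    push_neg at h
    constructor
    · intro he; exact nomatch he
    · rintro ⟨he, hd⟩
      exact (h d hd he).elim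

/-- The (S,c,P)-reachable part of W: the induced subweb of W whose documents
are exactly those (c,P)-reachable from S in W. -/
noncomputable def reachablePart (W : Web) (S : Set URI) (c : ReachCrit)
    (P : SparqlExpr) : Web where
  D := {d | Reachable W S c P d}
  data := W.data
  adoc := restrictAdoc W {d | Reachable W S c P d}
  data_fin := fun d hd => W.data_fin d (Reachable.mem_D hd)
  bnode_disj := fun d1 h1 d2 h2 hne =>
    W.bnode_disj d1 (Reachable.mem_D h1) d2 (Reachable.mem_D h2) hne
  adoc_mem := fun u d h => ((restrictAdoc_eq_some W _ u d).mp h).2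
  adoc_surj := fun d hd => by
    obtain ⟨u, hu⟩ := Reachable.exists_uri hd
    exact ⟨u, (restrictAdoc_eq_some W _ u d).mpr ⟨hu, hd⟩⟩

/-- The SPARQL_LD(R) (reachability-based semantics) query Q^{P,S,c}. -/
def reachQuery (P : SparqlExpr) (S : Set URI) (c : ReachCrit) : LDQuery :=
  fun W => eval P (Web.AllData (reachablePart W S c P))

/-- A reachability criterion ensures finiteness if every reachable part
(w.r.t. a finite seed set) has finitely many documents. -/
def EnsuresFiniteness (c : ReachCrit) : Prop :=
  ∀ (W : Web) (S : Set URI), S.Finite → ∀ P : SparqlExpr,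
    (reachablePart W S c P).D.Finite

lemma PatSP.apply_of_applyS {μ : Valu} {a : PatSP} {n : Node} {v : Var}
    (h : a.applyS μ = some n) (hv : v ∈ a.vars) : μ v = some n.toTerm := by
  cases a with
  | uri u => exact hv.elim
  | var w =>
    obtain rfl : v = w := hv
    simp only [PatSP.applyS] at h
    split at h <;> simp_all [Node.toTerm] <;> subst h <;> rfl

lemma PatSP.apply_of_applyP {μ : Valu} {a : PatSP} {p : URI} {v : Var}
    (h : a.applyP μ = some p) (hv : v ∈ a.vars) : μ v = some (Term.uri p) := by
  cases a with
  | uri u => exact hv.elim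
  | var w =>
    obtain rfl : v = w := hv
    simp only [PatSP.applyP] at h
    split at h <;> simp_all

lemma PatO.apply_of_applyO {μ : Valu} {a : PatO} {o : Term} {v : Var}
    (h : a.applyO μ = some o) (hv : v ∈ a.vars) : μ v = some o := by
  cases a with
  | uri u => exact hv.elim
  | lit l => exact hv.elim
  | var w =>
    obtain rfl : v = w := hv
    exact h

lemma TriplePattern.apply_eq_some {μ : Valu} {tp : TriplePattern} {t : RDFTriple}
    (h : tp.apply μ = some t) :
    tp.s.applyS μ = some t.s ∧ tp.p.applyP μ = some t.p ∧ tp.o.applyO μ = some t.o := by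
  unfold TriplePattern.apply at h
  split at h
  · cases h
    exact ⟨‹_›, ‹_›, ‹_›⟩
  · cases h

/-- A valuation defined exactly on the variables of a triple pattern is determined by the triple
it produces. -/
lemma TriplePattern.subsingleton_matches (tp : TriplePattern) (t : RDFTriple) :
    {μ : Valu | μ.dom = tp.vars ∧ tp.apply μ = some t}.Subsingleton := by
  rintro μ ⟨hμ, hμt⟩ ν ⟨hν, hνt⟩
  obtain ⟨hs, hp, ho⟩ := apply_eq_some hμt
  obtain ⟨hs', hp', ho'⟩ := apply_eq_some hνt
  funext v
  by_cases hv : v ∈ tp.vars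
  · rcases hv with (hv | hv) | hv
    · rw [PatSP.apply_of_applyS hs hv, PatSP.apply_of_applyS hs' hv]
    · rw [PatSP.apply_of_applyP hp hv, PatSP.apply_of_applyP hp' hv]
    · rw [PatO.apply_of_applyO ho hv, PatO.apply_of_applyO ho' hv]
  · have hμv : μ v = none := not_not.mp fun h => hv (hμ ▸ h)
    have hνv : ν v = none := not_not.mp fun h => hv (hν ▸ h)
    rw [hμv, hνv]

lemma Valu.finite_join {A B : Set Valu} (hA : A.Finite) (hB : B.Finite) :
    {μ | ∃ μ1 ∈ A, ∃ μ2 ∈ B, Valu.Compatible μ1 μ2 ∧ μ = Valu.union μ1 μ2}.Finite := by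
  refine (hA.image2 Valu.union hB).subset ?_
  rintro _ ⟨μ1, h1, μ2, h2, -, rfl⟩
  exact ⟨μ1, h1, μ2, h2, rfl⟩

lemma eval_finite (P : SparqlExpr) {G : Set RDFTriple} (hG : G.Finite) : (eval P G).Finite := by
  induction P with
  | pat tp =>
    refine (hG.biUnion fun t _ => (tp.subsingleton_matches t).finite).subset ?_
    rintro μ ⟨hμ, t, ht, h⟩
    exact Set.mem_biUnion ht ⟨hμ, h⟩
  | andE P1 P2 h1 h2 => exact Valu.finite_join h1 h2
  | unionE P1 P2 h1 h2 => exact h1.union h2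
  | optE P1 P2 h1 h2 => exact (Valu.finite_join h1 h2).union (h1.subset fun _ h => h.1)
  | filterE P R h => exact h.subset fun _ h => h.1

lemma Web.IsFinite.allData_finite {W : Web} (h : W.IsFinite) : W.AllData.Finite :=
  Set.Finite.biUnion h W.data_fin

/-- if the (S,c,P)-reachable part of W is finite then Q^{P,S,c}(W) is finite. -/
theorem statement_8 (P : SparqlExpr) (c : ReachCrit) (S : Set URI) (hS : S.Finite)
    (W : Web) (hfin : (reachablePart W S c P).IsFinite) :
    (reachQuery P S c W).Finite :=
  eval_finite P hfin.allData_finite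
end

section
/- Let P be any SPARQL expression and let S ⊂ U be a set of seed URIs with exactly one element. Then the SPARQL_LD(R) query Q^{P,S,c_None} under c_None-semantics is monotonic. -/
theorem eval_empty (P : SparqlExpr) : eval P ∅ = ∅ := by
  induction P with
  | pat tp => simp [eval]
  | andE P1 P2 ih1 ih2 => simp [eval, ih1]
  | unionE P1 P2 ih1 ih2 => simp [eval, ih1, ih2]
  | optE P1 P2 ih1 ih2 => simp [eval, ih1]
  | filterE P R ih => simp [eval, ih]

theorem reachable_cNone_iff {W : Web} {S : Set URI} {P : SparqlExpr} {d : Doc} :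
    Reachable W S cNone P d ↔ ∃ u ∈ S, W.adoc u = some d := by
  constructor
  · rintro (⟨hu, ha⟩ | ⟨-, -, -, hc, -⟩)
    · exact ⟨_, hu, ha⟩
    · exact absurd hc Bool.false_ne_true
  · rintro ⟨u, hu, ha⟩
    exact .seed hu ha

theorem mem_allData_reachablePart_cNone_singleton {W : Web} {u : URI} {P : SparqlExpr}
    {t : RDFTriple} :
    t ∈ (reachablePart W {u} cNone P).AllData ↔ ∃ d, W.adoc u = some d ∧ t ∈ W.data d := by
  simp [Web.AllData, reachablePart, reachable_cNone_iff]

/-- for a singleton seed set, Q^{P,S,c_None} is monotonic. -/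
theorem statement_16 (P : SparqlExpr) (u0 : URI) :
    LDQuery.Monotonic (reachQuery P {u0} cNone) := by
  intro W1 W2 ⟨_, hdata, hadoc⟩
  unfold reachQuery
  cases h : W1.adoc u0 with
  | none =>
    have hempty : (reachablePart W1 {u0} cNone P).AllData = ∅ := by
      ext t
      simp [mem_allData_reachablePart_cNone_singleton, h]
    rw [hempty, eval_empty]
    exact Set.empty_subset _
  | some d =>
    have heq : (reachablePart W1 {u0} cNone P).AllData =
        (reachablePart W2 {u0} cNone P).AllData := by
      ext t
      obtain ⟨h2, hd⟩ := (hadoc u0 d).mp h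
      simp [mem_allData_reachablePart_cNone_singleton, h, h2, hdata d hd]
    rw [heq]
end

section
/- For every finite set U0 ⊂ U of URIs and every finite set T0 of RDF triples, the U0-constant reachability criterion, the T0-constant reachability criterion, the (U0 ∧ T0)-constant reachability criterion, and the (U0 ∨ T0)-constant reachability criterion each ensure finiteness: for every Web of Linked Data W, every finite set S ⊂ U of seed URIs, and every SPARQL expression P, the corresponding (S,c,P)-reachable part of W has finitely many documents. -/
lemma RDFTriple.uris_finite (t : RDFTriple) : t.uris.Finite := by
  have hterms : t.terms.Finite := by
    unfold RDFTriple.terms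
    exact Set.toFinite _
  exact hterms.preimage fun _ _ _ _ h => Term.uri.inj h

/-- A criterion accepting only finitely many URIs (each for whatever triple mentioning it)
ensures finiteness. -/
lemma ensuresFiniteness_of_finite {c : ReachCrit} {A : Set URI} (hA : A.Finite)
    (hc : ∀ t, ∀ u ∈ RDFTriple.uris t, ∀ P, c t u P = true → u ∈ A) :
    EnsuresFiniteness c := by
  intro W S hS P
  refine Set.Finite.subset (((hS.union hA).image W.adoc).preimage
    (Option.some_injective Doc).injOn) ?_
  rintro d (⟨hu, ha⟩ | ⟨_, _, hu, hcu, ha⟩)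
  · exact ⟨_, Or.inl hu, ha⟩
  · exact ⟨_, Or.inr (hc _ _ hu P hcu), ha⟩

/-- the U0-constant, T0-constant, (U0 ∧ T0)-constant and
(U0 ∨ T0)-constant reachability criteria each ensure finiteness. -/
theorem statement_18 (U0 : Set URI) (hU0 : U0.Finite)
    (T0 : Set RDFTriple) (hT0 : T0.Finite)
    (cU cT cAnd cOr : ReachCrit)
    (hcU : ∀ t u P, cU t u P = true ↔ u ∈ U0)
    (hcT : ∀ t u P, cT t u P = true ↔ t ∈ T0)
    (hcAnd : ∀ t u P, cAnd t u P = true ↔ (u ∈ U0 ∧ t ∈ T0))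
    (hcOr : ∀ t u P, cOr t u P = true ↔ (u ∈ U0 ∨ t ∈ T0)) :
    EnsuresFiniteness cU ∧ EnsuresFiniteness cT ∧
    EnsuresFiniteness cAnd ∧ EnsuresFiniteness cOr := by
  have hT : (⋃ t ∈ T0, t.uris).Finite := hT0.biUnion fun t _ => t.uris_finite
  refine ⟨ensuresFiniteness_of_finite hU0 fun t u _ P h => (hcU t u P).1 h,
    ensuresFiniteness_of_finite hT fun t u hu P h =>
      Set.mem_biUnion ((hcT t u P).1 h) hu,
    ensuresFiniteness_of_finite hU0 fun t u _ P h => ((hcAnd t u P).1 h).1,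
    ensuresFiniteness_of_finite (hU0.union hT) fun t u hu P h => ?_⟩
  exact ((hcOr t u P).1 h).imp id fun ht => Set.mem_biUnion ht hu
end
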